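/- Let A ∈ ℝ^{n×n} be symmetric with nonnegative entries whose largest eigenvalue ρ > 0 is simple and satisfies |λ| < ρ for every other eigenvalue λ, and let v be a unit eigenvector of A for ρ with nonnegative entries (and v ≠ 0). For a partition indicator matrix H ∈ {0,1}^{n×k} of a partition C into k nonempty classes, define F(H) = lim_{t→∞} ρ^{-t} ‖A^t H − H (Hᵀ H)^{-1} Hᵀ A^t H‖₁. Then F(H) = (Σ_{i=1}^n v_i) · Σ_{i=1}^n | v_i − (1/|C(i)|) Σ_{l ∈ C(i)} v_l |. Consequently, a partition into k nonempty classes minimizes F among all such partitions if and only if it minimizes the one-dimensional clustering objective Σ_{i=1}^n | v_i − (mean of v over the class of i) |. -/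

import Mathlib

open Matrix Filter Finset

/-- The entrywise ℓ1 norm of a matrix: the sum of the absolute values of its entries. -/
noncomputable def l1norm {n k : ℕ} (M : Matrix (Fin n) (Fin k) ℝ) : ℝ :=
  ∑ i, ∑ j, |M i j|

/-- The indicator matrix of the partition of `Fin n` induced by `f : Fin n → Fin k`. -/
def indicatorMatrix {n k : ℕ} (f : Fin n → Fin k) : Matrix (Fin n) (Fin k) ℝ :=
  Matrix.of fun i j => if f i = j then (1 : ℝ) else 0

/-- The one-dimensional clustering objective: the sum over all `i` of the absolute deviation
of `v i` from the mean of `v` over the class of `i` in the partition induced by `f`. -/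
noncomputable def clusterObj {n k : ℕ} (v : Fin n → ℝ) (f : Fin n → Fin k) : ℝ :=
  ∑ i, |v i - (∑ l ∈ Finset.univ.filter fun l => f l = f i, v l) /
    ((Finset.univ.filter fun l => f l = f i).card : ℝ)|

/-- If the `ρ`-eigenspace of `A` is one-dimensional and contains the unit vector `v`, every
vector in it equals its orthogonal projection onto the line through `v`. -/
lemma eq_dotProduct_smul_of_finrank_eigenspace_eq_one {n : ℕ} {A : Matrix (Fin n) (Fin n) ℝ}
    {ρ : ℝ} (hsimple : Module.finrank ℝ (Module.End.eigenspace (Matrix.toLin' A) ρ) = 1)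
    {v : Fin n → ℝ} (hv : A *ᵥ v = ρ • v) (hvunit : v ⬝ᵥ v = 1)
    {w : Fin n → ℝ} (hw : A *ᵥ w = ρ • w) : w = (v ⬝ᵥ w) • v := by
  have hvm : v ∈ Module.End.eigenspace (Matrix.toLin' A) ρ := by
    simpa [Module.End.mem_eigenspace_iff] using hv
  have hwm : w ∈ Module.End.eigenspace (Matrix.toLin' A) ρ := by
    simpa [Module.End.mem_eigenspace_iff] using hw
  have hvne : (⟨v, hvm⟩ : Module.End.eigenspace (Matrix.toLin' A) ρ) ≠ 0 := by
    intro h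
    have hv0 : v = 0 := congrArg Subtype.val h
    simp [hv0] at hvunit
  obtain ⟨c, hc⟩ := (finrank_eq_one_iff_of_nonzero' _ hvne).1 hsimple ⟨w, hwm⟩
  have hcw : c • v = w := congrArg Subtype.val hc
  rw [← hcw, dotProduct_smul, hvunit, smul_eq_mul, mul_one]

lemma dotProduct_eq_zero_of_isSymm {n : ℕ} {A : Matrix (Fin n) (Fin n) ℝ} (hA : A.IsSymm)
    {ρ μ : ℝ} (hne : μ ≠ ρ) {v w : Fin n → ℝ} (hv : A *ᵥ v = ρ • v) (hw : A *ᵥ w = μ • w) :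
    v ⬝ᵥ w = 0 := by
  have h : v ⬝ᵥ (A *ᵥ w) = (A *ᵥ v) ⬝ᵥ w := by
    rw [dotProduct_mulVec, ← mulVec_transpose, hA.eq]
  rw [hv, hw, dotProduct_smul, smul_dotProduct, smul_eq_mul, smul_eq_mul] at h
  have h' : (μ - ρ) * (v ⬝ᵥ w) = 0 := by linarith
  exact (mul_eq_zero.1 h').resolve_left (sub_ne_zero.2 hne)

lemma pow_mulVec_of_mulVec_eq_smul {n : ℕ} {A : Matrix (Fin n) (Fin n) ℝ} {μ : ℝ}
    {w : Fin n → ℝ} (hw : A *ᵥ w = μ • w) (t : ℕ) : (A ^ t) *ᵥ w = μ ^ t • w := by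
  induction t with
  | zero => simp
  | succ t ih => rw [pow_succ, ← mulVec_mulVec, hw, mulVec_smul, ih, smul_smul, pow_succ']

/-- Power iteration: the rescaled powers of a symmetric matrix with a simple, strictly dominant
eigenvalue converge to the orthogonal projection onto the dominant eigenvector. -/
lemma tendsto_inv_pow_smul_pow_mulVec {n : ℕ} {A : Matrix (Fin n) (Fin n) ℝ} (hA : A.IsSymm)
    {ρ : ℝ} (hρpos : 0 < ρ)
    (hsimple : Module.finrank ℝ (Module.End.eigenspace (Matrix.toLin' A) ρ) = 1)
    (hdom : ∀ μ ∈ spectrum ℝ A, μ ≠ ρ → |μ| < ρ)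
    {v : Fin n → ℝ} (hv : A *ᵥ v = ρ • v) (hvunit : v ⬝ᵥ v = 1) (w : Fin n → ℝ) :
    Tendsto (fun t : ℕ => (ρ ^ t)⁻¹ • (A ^ t *ᵥ w)) atTop (nhds ((v ⬝ᵥ w) • v)) := by
  have hH : A.IsHermitian := by rw [IsHermitian, conjTranspose_eq_transpose_of_trivial, hA.eq]
  have hspan : WithLp.toLp 2 w ∈ Submodule.span ℝ (Set.range hH.eigenvectorBasis) := by
    rw [← hH.eigenvectorBasis.coe_toBasis, Module.Basis.span_eq]
    trivial
  suffices h : ∀ x ∈ Submodule.span ℝ (Set.range hH.eigenvectorBasis),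
      Tendsto (fun t : ℕ => (ρ ^ t)⁻¹ • (A ^ t *ᵥ x.ofLp)) atTop
        (nhds ((v ⬝ᵥ x.ofLp) • v)) from h _ hspan
  intro x hx
  induction hx using Submodule.span_induction with
  | mem x hx =>
    obtain ⟨j, rfl⟩ := hx
    have hj := hH.mulVec_eigenvectorBasis j
    by_cases hjρ : hH.eigenvalues j = ρ
    · rw [hjρ] at hj
      rw [← eq_dotProduct_smul_of_finrank_eigenspace_eq_one hsimple hv hvunit hj]
      refine tendsto_const_nhds.congr fun t => ?_
      rw [pow_mulVec_of_mulVec_eq_smul hj, smul_smul, inv_mul_cancel₀ (pow_pos hρpos t).ne',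
        one_smul]
    · rw [dotProduct_eq_zero_of_isSymm hA hjρ hv hj, zero_smul]
      have hlt : |hH.eigenvalues j / ρ| < 1 := by
        rw [abs_div, abs_of_pos hρpos, div_lt_one hρpos]
        exact hdom _ (hH.eigenvalues_mem_spectrum_real j) hjρ
      have hlim := (tendsto_pow_atTop_nhds_zero_of_abs_lt_one hlt).smul_const
        (hH.eigenvectorBasis j).ofLp
      rw [zero_smul] at hlim
      refine hlim.congr fun t => ?_
      rw [pow_mulVec_of_mulVec_eq_smul hj, smul_smul, div_pow, div_eq_inv_mul]
  | zero => simp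
  | add x y _ _ hx hy =>
    simpa [mulVec_add, smul_add, add_smul, dotProduct_add] using hx.add hy
  | smul c x _ hx =>
    simpa [mulVec_smul, dotProduct_smul, smul_smul, mul_comm, mul_assoc] using hx.const_smul c

lemma tendsto_inv_pow_smul_pow {n : ℕ} {A : Matrix (Fin n) (Fin n) ℝ} (hA : A.IsSymm)
    {ρ : ℝ} (hρpos : 0 < ρ)
    (hsimple : Module.finrank ℝ (Module.End.eigenspace (Matrix.toLin' A) ρ) = 1)
    (hdom : ∀ μ ∈ spectrum ℝ A, μ ≠ ρ → |μ| < ρ)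
    {v : Fin n → ℝ} (hv : A *ᵥ v = ρ • v) (hvunit : v ⬝ᵥ v = 1) :
    Tendsto (fun t : ℕ => (ρ ^ t)⁻¹ • A ^ t) atTop (nhds (vecMulVec v v)) := by
  refine tendsto_pi_nhds.2 fun i => tendsto_pi_nhds.2 fun j => ?_
  have h := tendsto_pi_nhds.1
    (tendsto_inv_pow_smul_pow_mulVec hA hρpos hsimple hdom hv hvunit (Pi.single j 1)) i
  simpa [vecMulVec_apply, mul_comm] using h

lemma continuous_l1norm {n k : ℕ} :
    Continuous (l1norm : Matrix (Fin n) (Fin k) ℝ → ℝ) := by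
  unfold l1norm
  fun_prop

lemma l1norm_smul {n k : ℕ} (c : ℝ) (M : Matrix (Fin n) (Fin k) ℝ) :
    l1norm (c • M) = |c| * l1norm M := by
  simp [l1norm, abs_mul, mul_sum]

lemma l1norm_vecMulVec {n k : ℕ} (x : Fin n → ℝ) (y : Fin k → ℝ) :
    l1norm (vecMulVec x y) = (∑ i, |x i|) * ∑ j, |y j| := by
  simp [l1norm, vecMulVec_apply, abs_mul, sum_mul_sum]

lemma transpose_indicatorMatrix_mul_self {n k : ℕ} (f : Fin n → Fin k) :
    (indicatorMatrix f)ᵀ * indicatorMatrix f =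
      diagonal fun j => ((univ.filter fun l => f l = j).card : ℝ) := by
  ext a b
  by_cases hab : a = b
  · subst hab
    simp [mul_apply, indicatorMatrix, ← ite_and]
  · rw [diagonal_apply_ne _ hab, mul_apply]
    refine sum_eq_zero fun l _ => ?_
    by_cases hl : f l = a <;> simp [indicatorMatrix, hl, hab]

/-- The orthogonal projection onto the column space of an indicator matrix averages over
classes. -/
lemma indicatorMatrix_projection_mulVec {n k : ℕ} {f : Fin n → Fin k}
    (hf : Function.Surjective f) (v : Fin n → ℝ) (i : Fin n) :
    ((indicatorMatrix f * ((indicatorMatrix f)ᵀ * indicatorMatrix f)⁻¹ *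
      (indicatorMatrix f)ᵀ) *ᵥ v) i =
      (∑ l ∈ univ.filter fun l => f l = f i, v l) /
        ((univ.filter fun l => f l = f i).card : ℝ) := by
  have hinv : ((indicatorMatrix f)ᵀ * indicatorMatrix f)⁻¹ =
      diagonal fun j => ((univ.filter fun l => f l = j).card : ℝ)⁻¹ := by
    rw [transpose_indicatorMatrix_mul_self]
    refine inv_eq_right_inv ?_
    rw [diagonal_mul_diagonal, ← diagonal_one]
    congr 1
    ext j
    obtain ⟨l, hl⟩ := hf j
    refine mul_inv_cancel₀ (Nat.cast_ne_zero.2 (card_ne_zero.2 ⟨l, ?_⟩))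
    simp [hl]
  rw [hinv, ← mulVec_mulVec, ← mulVec_mulVec]
  simp [mulVec, dotProduct, diagonal_apply, indicatorMatrix, sum_filter, div_eq_inv_mul]

lemma sum_abs_vecMul_indicatorMatrix {n k : ℕ} (f : Fin n → Fin k) {v : Fin n → ℝ}
    (hv : ∀ i, 0 ≤ v i) : ∑ j, |(v ᵥ* indicatorMatrix f) j| = ∑ i, v i := by
  have h : ∀ j, |(v ᵥ* indicatorMatrix f) j| = ∑ i, if f i = j then v i else 0 := fun j => by
    simp only [vecMul, dotProduct, indicatorMatrix, of_apply, mul_ite, mul_one, mul_zero]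
    refine abs_of_nonneg (sum_nonneg fun i _ => ?_)
    split_ifs
    exacts [hv i, le_rfl]
  rw [sum_congr rfl fun j _ => h j, sum_comm]
  simp

/-- The cost of the rank-one matrix `v vᵀ` is the clustering objective of `v`, up to the
factor `∑ i, v i`. -/
lemma l1norm_vecMulVec_cost {n k : ℕ} {f : Fin n → Fin k} (hf : Function.Surjective f)
    {v : Fin n → ℝ} (hv : ∀ i, 0 ≤ v i) :
    l1norm (vecMulVec v v * indicatorMatrix f -
      indicatorMatrix f * ((indicatorMatrix f)ᵀ * indicatorMatrix f)⁻¹ *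
        (indicatorMatrix f)ᵀ * vecMulVec v v * indicatorMatrix f) =
      (∑ i, v i) * clusterObj v f := by
  rw [mul_vecMulVec, vecMulVec_mul, vecMulVec_mul, ← sub_vecMulVec, l1norm_vecMulVec,
    sum_abs_vecMul_indicatorMatrix f hv, mul_comm]
  simp only [Pi.sub_apply, indicatorMatrix_projection_mulVec hf, clusterObj]

/-- Let `A` be symmetric with nonnegative entries, with simple strictly
dominant eigenvalue `ρ > 0` and nonnegative unit eigenvector `v ≠ 0`. For each partition of
`{1,…,n}` into `k` nonempty classes (surjective `f : Fin n → Fin k`) with indicator `H`, let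
`F f` be the long-term cost `lim_t ρ⁻ᵗ ‖Aᵗ H − H (HᵀH)⁻¹ Hᵀ Aᵗ H‖₁`. Then
`F f = (∑ᵢ vᵢ) · ∑ᵢ |vᵢ − (mean of v over the class of i)|`, and consequently a partition
minimizes `F` among all partitions into `k` nonempty classes iff it minimizes the
one-dimensional clustering objective on the entries of `v`. -/
theorem long_term_cost_eq_eigenvector_clustering {n k : ℕ}
    (A : Matrix (Fin n) (Fin n) ℝ) (hA : A.IsSymm) (hAnn : ∀ i j, 0 ≤ A i j)
    (ρ : ℝ) (hρpos : 0 < ρ) (hmem : ρ ∈ spectrum ℝ A)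
    (hsimple : Module.finrank ℝ (Module.End.eigenspace (Matrix.toLin' A) ρ) = 1)
    (hdom : ∀ μ ∈ spectrum ℝ A, μ ≠ ρ → |μ| < ρ)
    (v : Fin n → ℝ) (hv : A.mulVec v = ρ • v) (hvnn : ∀ i, 0 ≤ v i)
    (hvunit : ∑ i, v i ^ 2 = 1) (hvne : v ≠ 0)
    (F : (Fin n → Fin k) → ℝ)
    (hF : ∀ f : Fin n → Fin k, Function.Surjective f →
      Tendsto (fun t : ℕ => (ρ ^ t)⁻¹ *
          l1norm (A ^ t * indicatorMatrix f -
            indicatorMatrix f * ((indicatorMatrix f)ᵀ * indicatorMatrix f)⁻¹ *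
              (indicatorMatrix f)ᵀ * (A ^ t) * indicatorMatrix f))
        atTop (nhds (F f))) :
    (∀ f : Fin n → Fin k, Function.Surjective f → F f = (∑ i, v i) * clusterObj v f) ∧
      ∀ f : Fin n → Fin k, Function.Surjective f →
        ((∀ g : Fin n → Fin k, Function.Surjective g → F f ≤ F g) ↔
          ∀ g : Fin n → Fin k, Function.Surjective g → clusterObj v f ≤ clusterObj v g) := by
  have hunit : v ⬝ᵥ v = 1 := by
    rw [← hvunit]
    exact sum_congr rfl fun i _ => (sq (v i)).symm
  have hpow := tendsto_inv_pow_smul_pow hA hρpos hsimple hdom hv hunit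
  have hFeq : ∀ f : Fin n → Fin k, Function.Surjective f →
      F f = (∑ i, v i) * clusterObj v f := fun f hf => by
    refine tendsto_nhds_unique (hF f hf) ?_
    rw [← l1norm_vecMulVec_cost hf hvnn]
    have hcont : Continuous fun M : Matrix (Fin n) (Fin n) ℝ =>
        l1norm (M * indicatorMatrix f -
          indicatorMatrix f * ((indicatorMatrix f)ᵀ * indicatorMatrix f)⁻¹ *
            (indicatorMatrix f)ᵀ * M * indicatorMatrix f) :=
      continuous_l1norm.comp (by fun_prop)
    refine ((hcont.tendsto _).comp hpow).congr fun t => ?_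
    rw [Function.comp_apply, smul_mul, Matrix.mul_smul, smul_mul, ← smul_sub, l1norm_smul,
      abs_of_pos (inv_pos.2 (pow_pos hρpos t))]
  have hsum : 0 < ∑ i, v i := by
    obtain ⟨i, hi⟩ := Function.ne_iff.1 hvne
    exact sum_pos' (fun j _ => hvnn j) ⟨i, mem_univ i, lt_of_le_of_ne (hvnn i) (Ne.symm hi)⟩
  refine ⟨hFeq, fun f hf => forall₂_congr fun g hg => ?_⟩
  rw [hFeq f hf, hFeq g hg, mul_le_mul_iff_right₀ hsum]
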